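/- Let ξ = (ξ_1,…,ξ_n) be points of [0,1]^q and let f : [0,1]^q → ℝ have finite variation V(f) in the measure sense, i.e. f(x) = f(𝟏) + ν([0, 𝟏−x]) for a signed measure ν on [0,1]^q with ν({0}) = 0 and total variation |ν|([0,1]^q) = V(f). Then |(1/n)Σ_{k=1}^n f(ξ_k) − ∫_{[0,1]^q} f dλ_q| ≤ V(f) · D*_n(ξ), where D*_n(ξ) is the star discrepancy. -/

import Mathlib

open MeasureTheory Finset

/-- The simplex-type set used in the Fubini argument. -/
def khS (q : ℕ) : Set ((Fin q → ℝ) × (Fin q → ℝ)) :=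
  {p | 0 ≤ p.1 ∧ 0 ≤ p.2 ∧ p.2 + p.1 ≤ 1}

/-- Its indicator. -/
noncomputable def khI (q : ℕ) (x y : Fin q → ℝ) : ℝ :=
  (khS q).indicator (fun _ => (1 : ℝ)) (x, y)

lemma khS_meas (q : ℕ) : MeasurableSet (khS q) := by
  apply IsClosed.measurableSet
  unfold khS
  refine (isClosed_le continuous_const continuous_fst).inter
    ((isClosed_le continuous_const continuous_snd).inter
    (isClosed_le (continuous_snd.add continuous_fst) continuous_const))

lemma khI_meas (q : ℕ) : Measurable (fun p : (Fin q → ℝ) × (Fin q → ℝ) => khI q p.1 p.2) :=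
  measurable_const.indicator (khS_meas q)

lemma khI_le (q : ℕ) (x y : Fin q → ℝ) : ‖khI q x y‖ ≤ 1 := by
  unfold khI
  by_cases h : (x, y) ∈ khS q <;> simp [h]

lemma khI_left (q : ℕ) (x : Fin q → ℝ) (hx : 0 ≤ x) (y : Fin q → ℝ) :
    khI q x y = (Set.Icc 0 (1 - x)).indicator (fun _ => (1 : ℝ)) y := by
  have : (x, y) ∈ khS q ↔ y ∈ Set.Icc 0 (1 - x) := by
    simp [khS, hx, le_sub_iff_add_le]
  unfold khI
  by_cases h : y ∈ Set.Icc 0 (1 - x)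
  · rw [Set.indicator_of_mem h, Set.indicator_of_mem (this.2 h)]
  · rw [Set.indicator_of_notMem h, Set.indicator_of_notMem (fun h' => h (this.1 h'))]

lemma khI_right (q : ℕ) (y : Fin q → ℝ) (hy : 0 ≤ y) (x : Fin q → ℝ) :
    khI q x y = (Set.Icc 0 (1 - y)).indicator (fun _ => (1 : ℝ)) x := by
  have : (x, y) ∈ khS q ↔ x ∈ Set.Icc 0 (1 - y) := by
    simp [khS, hy, le_sub_iff_add_le, add_comm]
  unfold khI
  by_cases h : x ∈ Set.Icc 0 (1 - y)
  · rw [Set.indicator_of_mem h, Set.indicator_of_mem (this.2 h)]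
  · rw [Set.indicator_of_notMem h, Set.indicator_of_notMem (fun h' => h (this.1 h'))]

lemma khI_out (q : ℕ) (y : Fin q → ℝ) (hy : y ∉ Set.Icc (0 : Fin q → ℝ) 1) (x : Fin q → ℝ) :
    khI q x y = 0 := by
  unfold khI
  apply Set.indicator_of_notMem
  rintro ⟨h1, h2, h3⟩
  exact hy ⟨h2, le_trans (le_add_of_nonneg_right h1) h3⟩

lemma kh_vol (q : ℕ) (x : Fin q → ℝ) (hx : 0 ≤ x) :
    (volume : Measure (Fin q → ℝ)).real (Set.Icc 0 x) = ∏ i, x i := by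
  rw [Measure.real, Real.volume_Icc_pi_toReal hx]
  simp

lemma kh_int (q : ℕ) (y : Fin q → ℝ) (hy : y ∈ Set.Icc (0 : Fin q → ℝ) 1) :
    ∫ x in Set.Icc (0 : Fin q → ℝ) 1, khI q x y = ∏ i, (1 - y) i := by
  simp_rw [khI_right q y hy.1]
  rw [integral_indicator measurableSet_Icc, Measure.restrict_restrict measurableSet_Icc,
    Set.inter_eq_left.2 (Set.Icc_subset_Icc le_rfl (sub_le_self 1 hy.1))]
  rw [← kh_vol q _ (sub_nonneg.2 hy.2)]
  simp

lemma kh_finite (q : ℕ) : IsFiniteMeasure ((volume : Measure (Fin q → ℝ)).restrict (Set.Icc 0 1)) :=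
  ⟨by rw [Measure.restrict_apply_univ]; exact isCompact_Icc.measure_lt_top⟩

lemma kh_F (q : ℕ) (μ : Measure (Fin q → ℝ)) (x : Fin q → ℝ) (hx : 0 ≤ x) :
    μ.real (Set.Icc 0 (1 - x)) = ∫ y, khI q x y ∂μ := by
  simp_rw [khI_left q x hx]
  rw [integral_indicator measurableSet_Icc]
  simp

lemma kh_intble (q : ℕ) (μ : Measure (Fin q → ℝ)) [IsFiniteMeasure μ] :
    Integrable (fun p : (Fin q → ℝ) × (Fin q → ℝ) => khI q p.1 p.2)
      (((volume : Measure (Fin q → ℝ)).restrict (Set.Icc 0 1)).prod μ) := by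
  have := kh_finite q
  exact Integrable.of_bound (khI_meas q).aestronglyMeasurable 1
    (Filter.Eventually.of_forall fun p => khI_le q p.1 p.2)

lemma kh_intF (q : ℕ) (μ : Measure (Fin q → ℝ)) [IsFiniteMeasure μ] :
    IntegrableOn (fun x => μ.real (Set.Icc 0 (1 - x))) (Set.Icc 0 1) := by
  have := kh_finite q
  have h := (kh_intble q μ).integral_prod_left
  refine (integrableOn_congr_fun ?_ measurableSet_Icc).1 h
  intro x hx
  exact (kh_F q μ x hx.1).symm

lemma kh_pos (q n : ℕ) (ξ : Fin n → (Fin q → ℝ))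
    (hξ : ∀ k, ξ k ∈ Set.Icc (0 : Fin q → ℝ) 1) (μ : Measure (Fin q → ℝ)) [IsFiniteMeasure μ]
    (D : ℝ) (hD0 : 0 ≤ D)
    (hD : ∀ x ∈ Set.Icc (0 : Fin q → ℝ) 1,
      |(1 / (n : ℝ)) * ∑ k, (Set.Icc 0 x).indicator (fun _ => (1 : ℝ)) (ξ k) - ∏ i, x i| ≤ D) :
    |(1 / (n : ℝ)) * ∑ k, μ.real (Set.Icc 0 (1 - ξ k))
      - ∫ x in Set.Icc (0 : Fin q → ℝ) 1, μ.real (Set.Icc 0 (1 - x))| ≤ D * μ.real Set.univ := by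
  have := kh_finite q
  have h1 : ∫ x in Set.Icc (0 : Fin q → ℝ) 1, μ.real (Set.Icc 0 (1 - x))
      = ∫ y, (∫ x in Set.Icc (0 : Fin q → ℝ) 1, khI q x y) ∂μ := by
    rw [← integral_integral_swap (kh_intble q μ)]
    exact setIntegral_congr_fun measurableSet_Icc fun x hx => kh_F q μ x hx.1
  have hk : ∀ k, Integrable (fun y => khI q (ξ k) y) μ := fun k =>
    Integrable.of_bound ((khI_meas q).comp measurable_prodMk_left).aestronglyMeasurable 1
      (Filter.Eventually.of_forall fun y => khI_le q (ξ k) y)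
  have h2 : (1 / (n : ℝ)) * ∑ k, μ.real (Set.Icc 0 (1 - ξ k))
      = ∫ y, (1 / (n : ℝ)) * ∑ k, khI q (ξ k) y ∂μ := by
    rw [integral_const_mul, integral_finsetSum _ (fun k _ => hk k)]
    congr 1
    exact Finset.sum_congr rfl fun k _ => kh_F q μ _ (hξ k).1
  have h3 : Integrable (fun y => ∫ x in Set.Icc (0 : Fin q → ℝ) 1, khI q x y) μ :=
    (kh_intble q μ).integral_prod_right
  rw [h1, h2, ← integral_sub ((integrable_finsetSum _ fun k _ => hk k).const_mul _)
    h3, ← Real.norm_eq_abs]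
  refine norm_integral_le_of_norm_le_const (Filter.Eventually.of_forall fun y => ?_)
  by_cases hy : y ∈ Set.Icc (0 : Fin q → ℝ) 1
  · rw [kh_int q y hy, Real.norm_eq_abs]
    simp_rw [khI_right q y hy.1]
    exact hD (1 - y) ⟨sub_nonneg.2 hy.2, sub_le_self 1 hy.1⟩
  · simp_rw [khI_out q y hy]
    simpa using hD0

/-- Koksma–Hlawka inequality for a function with finite variation in the measure sense. -/
theorem stmt_5 (q n : ℕ) (hn : 0 < n) (ξ : Fin n → (Fin q → ℝ))
    (hξ : ∀ k, ξ k ∈ Set.Icc (0 : Fin q → ℝ) 1)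
    (f : (Fin q → ℝ) → ℝ) (ν : MeasureTheory.SignedMeasure (Fin q → ℝ))
    (hν0 : ν {0} = 0)
    (hrep : ∀ x ∈ Set.Icc (0 : Fin q → ℝ) 1, f x = f 1 + ν (Set.Icc 0 (1 - x))) :
    |(1 / (n : ℝ)) * ∑ k, f (ξ k) - ∫ x in Set.Icc (0 : Fin q → ℝ) 1, f x| ≤
      (ν.totalVariation Set.univ).toReal *
        sSup {r : ℝ | ∃ x ∈ Set.Icc (0 : Fin q → ℝ) 1,
          r = |(1 / (n : ℝ)) * ∑ k, (Set.Icc 0 x).indicator (fun _ => (1 : ℝ)) (ξ k) -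
                ∏ i, x i|} := by
  have hn' : (0 : ℝ) < n := by exact_mod_cast hn
  set A := {r : ℝ | ∃ x ∈ Set.Icc (0 : Fin q → ℝ) 1,
          r = |(1 / (n : ℝ)) * ∑ k, (Set.Icc 0 x).indicator (fun _ => (1 : ℝ)) (ξ k) -
                ∏ i, x i|} with hA
  have hD0 : 0 ≤ sSup A := by
    apply Real.sSup_nonneg
    rintro r ⟨x, hx, rfl⟩
    exact abs_nonneg _
  have hbdd : BddAbove A := by
    refine ⟨1, ?_⟩
    rintro r ⟨x, hx, rfl⟩
    have p0 : 0 ≤ ∏ i, x i := Finset.prod_nonneg fun i _ => hx.1 i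
    have p1 : ∏ i, x i ≤ 1 := Finset.prod_le_one (fun i _ => hx.1 i) fun i _ => hx.2 i
    have s0 : 0 ≤ ∑ k, (Set.Icc 0 x).indicator (fun _ => (1 : ℝ)) (ξ k) :=
      Finset.sum_nonneg fun k _ => Set.indicator_nonneg (fun _ _ => zero_le_one) _
    have s1 : ∑ k, (Set.Icc 0 x).indicator (fun _ => (1 : ℝ)) (ξ k) ≤ n := by
      calc _ ≤ ∑ k : Fin n, (1 : ℝ) :=
            Finset.sum_le_sum fun k _ => Set.indicator_le_self' (fun _ _ => zero_le_one) _
        _ = n := by simp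
    have t0 : 0 ≤ (1 / (n : ℝ)) * ∑ k, (Set.Icc 0 x).indicator (fun _ => (1 : ℝ)) (ξ k) := by
      positivity
    have t1 : (1 / (n : ℝ)) * ∑ k, (Set.Icc 0 x).indicator (fun _ => (1 : ℝ)) (ξ k) ≤ 1 := by
      rw [one_div, inv_mul_le_iff₀ hn']
      simpa using s1
    rw [abs_le]
    constructor <;> linarith
  have hD : ∀ x ∈ Set.Icc (0 : Fin q → ℝ) 1,
      |(1 / (n : ℝ)) * ∑ k, (Set.Icc 0 x).indicator (fun _ => (1 : ℝ)) (ξ k) - ∏ i, x i|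
        ≤ sSup A := fun x hx => le_csSup hbdd ⟨x, hx, rfl⟩
  set P := ν.toJordanDecomposition.posPart with hP
  set N := ν.toJordanDecomposition.negPart with hN
  have hν : ∀ s, MeasurableSet s → ν s = P.real s - N.real s := by
    intro s hs
    conv_lhs => rw [← ν.toSignedMeasure_toJordanDecomposition]
    simp [JordanDecomposition.toSignedMeasure, hs, hP, hN]
  have hp := kh_pos q n ξ hξ P (sSup A) hD0 hD
  have hm := kh_pos q n ξ hξ N (sSup A) hD0 hD
  have hrep' : ∀ x ∈ Set.Icc (0 : Fin q → ℝ) 1,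
      f x = f 1 + (P.real (Set.Icc 0 (1 - x)) - N.real (Set.Icc 0 (1 - x))) := fun x hx => by
    rw [← hν _ measurableSet_Icc]; exact hrep x hx
  have := kh_finite q
  have hI : ∫ x in Set.Icc (0 : Fin q → ℝ) 1, f x = f 1 +
      ((∫ x in Set.Icc (0 : Fin q → ℝ) 1, P.real (Set.Icc 0 (1 - x)))
        - ∫ x in Set.Icc (0 : Fin q → ℝ) 1, N.real (Set.Icc 0 (1 - x))) := by
    have h4 : Integrable (fun x => P.real (Set.Icc 0 (1 - x)) - N.real (Set.Icc 0 (1 - x)))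
      ((volume : Measure (Fin q → ℝ)).restrict (Set.Icc 0 1)) := (kh_intF q P).sub (kh_intF q N)
    rw [setIntegral_congr_fun measurableSet_Icc hrep',
      integral_add (integrable_const _) h4,
      integral_sub (kh_intF q P) (kh_intF q N)]
    congr 1
    rw [setIntegral_const, kh_vol q 1 zero_le_one]
    simp
  have hS : (1 / (n : ℝ)) * ∑ k, f (ξ k) = f 1 +
      ((1 / (n : ℝ)) * ∑ k, P.real (Set.Icc 0 (1 - ξ k))
        - (1 / (n : ℝ)) * ∑ k, N.real (Set.Icc 0 (1 - ξ k))) := by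
    rw [Finset.sum_congr rfl fun k _ => hrep' (ξ k) (hξ k), Finset.sum_add_distrib,
      Finset.sum_sub_distrib]
    simp only [Finset.sum_const, Finset.card_univ, Fintype.card_fin, nsmul_eq_mul]
    field_simp
  have hT : (ν.totalVariation Set.univ).toReal = P.real Set.univ + N.real Set.univ := by
    rw [SignedMeasure.totalVariation, Measure.add_apply,
      ENNReal.toReal_add (measure_ne_top _ _) (measure_ne_top _ _)]
    rfl
  rw [hI, hS, hT]
  rw [abs_le] at hp hm ⊢
  constructor <;> linarith [hp.1, hp.2, hm.1, hm.2]
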